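/- Let Λ ⊂ ℝ² be a lattice such that no ℤ-basis (λ₁, λ₂) of Λ satisfies ⟨λ₁,λ₂⟩ = 0, or 2⟨λ₁,λ₂⟩ = ‖λ₁‖², or ‖λ₁‖ = ‖λ₂‖. Then the function det DΘ_Λ(τ) = (1/2)·Σ_{(λ,μ)∈Λ×Λ} ⟨λ,μ⟩·det(λ,μ)·(‖μ‖² − ‖λ‖²)·exp(2πi(‖λ‖²+‖μ‖²)τ) is not identically zero on the upper half plane. -/

import Mathlib

open scoped BigOperators

noncomputable section

/-- The standard Euclidean inner product on `ℝ²`. -/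
def ip (v w : Fin 2 → ℝ) : ℝ := ∑ i, v i * w i

/-- The squared Euclidean norm on `ℝ²`. -/
def nsq (v : Fin 2 → ℝ) : ℝ := ∑ i, v i ^ 2

/-- `det(λ,μ) = λ₁μ₂ − λ₂μ₁`. -/
def det2 (v w : Fin 2 → ℝ) : ℝ := v 0 * w 1 - v 1 * w 0

/-- `q^t = exp(2 π i t τ)`. -/
def eq2 (t : ℝ) (τ : ℂ) : ℂ := Complex.exp (2 * Real.pi * Complex.I * t * τ)

/-- The lattice vector `Σᵢ cᵢ bᵢ` attached to the integer coefficient vector `c`. -/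
def LV (b : Fin 2 → Fin 2 → ℝ) (c : Fin 2 → ℤ) : Fin 2 → ℝ :=
  ∑ i, (c i : ℝ) • b i

/-- `det DΘ_Λ(τ) = (1/2) Σ_{(λ,μ) ∈ Λ×Λ} ⟨λ,μ⟩ det(λ,μ) (‖μ‖² − ‖λ‖²) q^{‖λ‖²+‖μ‖²}`
for the lattice `Λ` spanned by `b`. -/
def detDTheta (b : Fin 2 → Fin 2 → ℝ) (τ : ℂ) : ℂ :=
  (1 / 2 : ℂ) *
    ∑' cd : (Fin 2 → ℤ) × (Fin 2 → ℤ),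
      ((ip (LV b cd.1) (LV b cd.2) * det2 (LV b cd.1) (LV b cd.2) *
          (nsq (LV b cd.2) - nsq (LV b cd.1)) : ℝ) : ℂ) *
        eq2 (nsq (LV b cd.1) + nsq (LV b cd.2)) τ

/-- The set of integer combinations of `v` and `w`. -/
def intSpan (v w : Fin 2 → ℝ) : Set (Fin 2 → ℝ) :=
  {x | ∃ a a' : ℤ, x = (a : ℝ) • v + (a' : ℝ) • w}

theorem intSpan_swap (v w : Fin 2 → ℝ) : intSpan w v = intSpan v w := by
  ext x
  constructor <;> rintro ⟨a, a', rfl⟩ <;> exact ⟨a', a, add_comm _ _⟩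

theorem intSpan_neg_right (v w : Fin 2 → ℝ) : intSpan v (-w) = intSpan v w := by
  ext x
  constructor <;> rintro ⟨a, a', rfl⟩ <;> exact ⟨a, -a', by simp⟩

theorem intSpan_add_right (v w : Fin 2 → ℝ) : intSpan v (w + v) = intSpan v w := by
  ext x
  constructor <;> rintro ⟨a, a', rfl⟩
  · exact ⟨a + a', a', by push_cast; module⟩
  · exact ⟨a - a', a', by push_cast; module⟩

theorem intSpan_sub_right (v w : Fin 2 → ℝ) : intSpan v (w - v) = intSpan v w := by
  rw [← intSpan_add_right v (w - v), sub_add_cancel]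

theorem LV_eq (b : Fin 2 → Fin 2 → ℝ) (c : Fin 2 → ℤ) :
    LV b c = (c 0 : ℝ) • b 0 + (c 1 : ℝ) • b 1 := by
  simp [LV, Fin.sum_univ_two]

theorem range_LV (b : Fin 2 → Fin 2 → ℝ) :
    {x | ∃ c : Fin 2 → ℤ, x = LV b c} = intSpan (b 0) (b 1) := by
  ext x
  constructor
  · rintro ⟨c, rfl⟩
    exact ⟨c 0, c 1, LV_eq b c⟩
  · rintro ⟨a, a', rfl⟩
    exact ⟨![a, a'], by simp [LV_eq]⟩

theorem left_mem_intSpan (v w : Fin 2 → ℝ) : v ∈ intSpan v w := ⟨1, 0, by simp⟩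

theorem right_mem_intSpan (v w : Fin 2 → ℝ) : w ∈ intSpan v w := ⟨0, 1, by simp⟩

theorem nsq_nonneg (v : Fin 2 → ℝ) : 0 ≤ nsq v := by
  unfold nsq; positivity

theorem det2_ne_zero {b : Fin 2 → Fin 2 → ℝ} (hb : LinearIndependent ℝ b) :
    det2 (b 0) (b 1) ≠ 0 := by
  have h := (Matrix.linearIndependent_rows_iff_isUnit (A := Matrix.of b)).1 hb
  rw [Matrix.isUnit_iff_isUnit_det, Matrix.det_fin_two, isUnit_iff_ne_zero] at h
  intro h0
  apply h
  simp only [det2] at h0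
  simp only [Matrix.of_apply]
  linarith

theorem det2_comb (v w : Fin 2 → ℝ) (x y x' y' : ℝ) :
    det2 (x • v + y • w) (x' • v + y' • w) = (x * y' - y * x') * det2 v w := by
  simp [det2]; ring

theorem nsq_comb (v w : Fin 2 → ℝ) (x y : ℝ) :
    nsq (x • v + y • w) = nsq v * x ^ 2 + 2 * ip v w * x * y + nsq w * y ^ 2 := by
  simp [nsq, ip]; ring

theorem exists_pos_mul_le_nsq {b : Fin 2 → Fin 2 → ℝ} (hb : LinearIndependent ℝ b) :
    ∃ δ : ℝ, 0 < δ ∧ ∀ c : Fin 2 → ℤ,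
      δ * ((c 0 : ℝ) ^ 2 + (c 1 : ℝ) ^ 2) ≤ nsq (LV b c) := by
  have hD : 0 < det2 (b 0) (b 1) ^ 2 := by have := det2_ne_zero hb; positivity
  have hDeq : det2 (b 0) (b 1) ^ 2 = nsq (b 0) * nsq (b 1) - ip (b 0) (b 1) ^ 2 := by
    simp [det2, nsq, ip]; ring
  have hA := nsq_nonneg (b 0)
  have hC := nsq_nonneg (b 1)
  have hpos : 0 < nsq (b 0) + nsq (b 1) := by
    rcases hA.eq_or_lt with h | h
    · rw [← h] at hDeq; nlinarith [sq_nonneg (ip (b 0) (b 1))]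
    · linarith
  refine ⟨_, div_pos hD hpos, fun c => ?_⟩
  rw [div_mul_eq_mul_div, div_le_iff₀ hpos, LV_eq, nsq_comb, hDeq]
  generalize (c 0 : ℝ) = x
  generalize (c 1 : ℝ) = y
  generalize nsq (b 0) = A
  generalize nsq (b 1) = C
  generalize ip (b 0) (b 1) = B
  nlinarith [sq_nonneg (A * x + B * y), sq_nonneg (B * x + C * y)]

theorem finite_nsq_LV_le {b : Fin 2 → Fin 2 → ℝ} (hb : LinearIndependent ℝ b) (R : ℝ) :
    {c : Fin 2 → ℤ | nsq (LV b c) ≤ R}.Finite := by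
  obtain ⟨δ, hδ, h⟩ := exists_pos_mul_le_nsq hb
  obtain ⟨N, hN⟩ := exists_nat_ge (R / δ)
  refine (Set.finite_Icc (fun _ => -(N : ℤ)) (fun _ => (N : ℤ))).subset fun c hc => ?_
  have h1 : (c 0 : ℝ) ^ 2 + (c 1 : ℝ) ^ 2 ≤ N := by
    refine le_trans ?_ hN
    rw [le_div_iff₀ hδ, mul_comm]
    exact (h c).trans hc
  have h2 : c 0 ^ 2 + c 1 ^ 2 ≤ (N : ℤ) := by exact_mod_cast h1
  have h3 : ∀ i, c i ^ 2 ≤ (N : ℤ) := by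
    intro i
    fin_cases i <;> simp <;> nlinarith [sq_nonneg (c 0), sq_nonneg (c 1)]
  constructor <;> intro i <;> have := h3 i <;> simp only <;> nlinarith

/-- A lattice none of whose bases is special has a basis that is strictly reduced. -/
theorem exists_reduced_basis {b : Fin 2 → Fin 2 → ℝ} (hb : LinearIndependent ℝ b)
    (h : ∀ v w : Fin 2 → ℝ, intSpan v w = intSpan (b 0) (b 1) →
      ¬(ip v w = 0 ∨ 2 * ip v w = nsq v ∨ nsq v = nsq w)) :
    ∃ v w : Fin 2 → ℝ, intSpan v w = intSpan (b 0) (b 1) ∧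
      0 < 2 * ip v w ∧ 2 * ip v w < nsq v ∧ nsq v < nsq w := by
  let S : Set ((Fin 2 → ℤ) × (Fin 2 → ℤ)) :=
    {p | intSpan (LV b p.1) (LV b p.2) = intSpan (b 0) (b 1)}
  let f : (Fin 2 → ℤ) × (Fin 2 → ℤ) → ℝ := fun p => nsq (LV b p.1) + nsq (LV b p.2)
  let p₀ : (Fin 2 → ℤ) × (Fin 2 → ℤ) := (![1, 0], ![0, 1])
  have hp₀ : p₀ ∈ S := by simp [S, p₀, LV_eq]
  have hfin : (S ∩ {p | f p ≤ f p₀}).Finite := by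
    refine ((finite_nsq_LV_le hb (f p₀)).prod (finite_nsq_LV_le hb (f p₀))).subset ?_
    rintro p ⟨-, hp⟩
    have h1 := nsq_nonneg (LV b p.1)
    have h2 := nsq_nonneg (LV b p.2)
    have h3 : nsq (LV b p.1) + nsq (LV b p.2) ≤ f p₀ := hp
    exact ⟨by simp only [Set.mem_ofPred_eq]; linarith, by simp only [Set.mem_ofPred_eq]; linarith⟩
  obtain ⟨p, ⟨hpS, hp⟩, hmin'⟩ := Set.exists_min_image _ f hfin ⟨p₀, hp₀, le_refl (f p₀)⟩
  have hmin : ∀ v w, intSpan v w = intSpan (b 0) (b 1) → f p ≤ nsq v + nsq w := by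
    intro v w hvw
    have hv : v ∈ intSpan (b 0) (b 1) := hvw ▸ left_mem_intSpan v w
    have hw : w ∈ intSpan (b 0) (b 1) := hvw ▸ right_mem_intSpan v w
    rw [← range_LV] at hv hw
    obtain ⟨c, rfl⟩ := hv
    obtain ⟨d, rfl⟩ := hw
    rcases le_total (f (c, d)) (f p₀) with hle | hle
    · exact hmin' (c, d) ⟨hvw, hle⟩
    · exact le_trans hp hle
  obtain ⟨v, w, hvw, hlt, hE⟩ : ∃ v w, intSpan v w = intSpan (b 0) (b 1) ∧ nsq v < nsq w ∧
      nsq v + nsq w = f p := by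
    rcases lt_trichotomy (nsq (LV b p.1)) (nsq (LV b p.2)) with hlt | heq | hlt
    · exact ⟨_, _, hpS, hlt, rfl⟩
    · exact absurd (Or.inr (Or.inr heq)) (h _ _ hpS)
    · exact ⟨_, _, (intSpan_swap _ _).trans hpS, hlt, add_comm _ _⟩
  obtain ⟨w, hvw, hlt, hE, hpos⟩ : ∃ w, intSpan v w = intSpan (b 0) (b 1) ∧ nsq v < nsq w ∧
      nsq v + nsq w = f p ∧ 0 < ip v w := by
    have hneg : nsq (-w) = nsq w := by simp [nsq]
    rcases lt_trichotomy (ip v w) 0 with h0 | h0 | h0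
    · refine ⟨-w, (intSpan_neg_right v w).trans hvw, by rwa [hneg], by rwa [hneg], ?_⟩
      simp [ip] at h0 ⊢; linarith
    · exact absurd (Or.inl h0) (h _ _ hvw)
    · exact ⟨w, hvw, hlt, hE, h0⟩
  refine ⟨v, w, hvw, by linarith, lt_of_le_of_ne ?_ fun h0 => h _ _ hvw (Or.inr (Or.inl h0)), hlt⟩
  have h1 := hmin v (w - v) ((intSpan_sub_right v w).trans hvw)
  have h2 : nsq (w - v) = nsq w - 2 * ip v w + nsq v := by simp [nsq, ip]; ring
  linarith

section ReducedForm

variable {a b c : ℝ} (x y : ℤ)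

theorem reduced_form_ge (hc : 0 < c) (hca : c < a) (hxy : x ≠ 0 ∨ y ≠ 0) :
    a + (b - a) * (y : ℝ) ^ 2 + (a - c) * |(x : ℝ) * y| ≤ a * x ^ 2 + c * x * y + b * y ^ 2 := by
  have h1 : 1 ≤ x ^ 2 - |x * y| + y ^ 2 := by
    have hpos : 0 < x ^ 2 + y ^ 2 := by
      rcases hxy with h | h
      · positivity
      · positivity
    rw [abs_mul, ← sq_abs x, ← sq_abs y] at *
    nlinarith [sq_nonneg (|x| - |y|), abs_nonneg x, abs_nonneg y]
  have h2 : (1 : ℝ) ≤ (x : ℝ) ^ 2 - |(x : ℝ) * y| + (y : ℝ) ^ 2 := by exact_mod_cast h1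
  have h3 := neg_abs_le ((x : ℝ) * y)
  nlinarith [mul_le_mul_of_nonneg_left h2 (hc.trans hca).le, mul_le_mul_of_nonneg_left h3 hc.le]

theorem reduced_form_right (hc : 0 < c) (hca : c < a) (hab : a < b) (hy : y ≠ 0) :
    b ≤ a * x ^ 2 + c * x * y + b * y ^ 2 ∧
      (a * x ^ 2 + c * x * y + b * y ^ 2 ≤ b → x = 0 ∧ (y : ℝ) ^ 2 = 1) := by
  have h := reduced_form_ge (b := b) x y hc hca (Or.inr hy)
  have h1 : (1 : ℝ) ≤ (y : ℝ) ^ 2 := by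
    have : 1 ≤ y ^ 2 := by have : 0 < y ^ 2 := by positivity
                           linarith
    exact_mod_cast this
  have h2 := mul_le_mul_of_nonneg_left h1 (sub_pos.2 hab).le
  have h3 := mul_nonneg (sub_pos.2 hca).le (abs_nonneg ((x : ℝ) * y))
  refine ⟨by linarith, fun hle => ?_⟩
  have h4 : (a - c) * |(x : ℝ) * y| = 0 := by linarith
  have h5 : (x : ℝ) * y = 0 := by
    simpa [(sub_pos.2 hca).ne'] using h4
  have h6 : x = 0 := by simpa [hy] using h5
  refine ⟨h6, le_antisymm ?_ h1⟩
  by_contra! hlt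
  have := mul_lt_mul_of_pos_left hlt (sub_pos.2 hab)
  linarith

theorem reduced_form_left (hc : 0 < c) (hca : c < a) (hab : a < b) (hxy : x ≠ 0 ∨ y ≠ 0) :
    a ≤ a * x ^ 2 + c * x * y + b * y ^ 2 ∧
      (a * x ^ 2 + c * x * y + b * y ^ 2 ≤ a → (x : ℝ) ^ 2 = 1 ∧ y = 0) := by
  by_cases hy : y = 0
  · subst hy
    have hx : x ≠ 0 := by simpa using hxy
    have h1 : (1 : ℝ) ≤ (x : ℝ) ^ 2 := by
      have : 1 ≤ x ^ 2 := by have : 0 < x ^ 2 := by positivity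
                             linarith
      exact_mod_cast this
    simp only [Int.cast_zero, mul_zero, add_zero, ne_eq, OfNat.ofNat_ne_zero, not_false_eq_true,
      zero_pow]
    refine ⟨by nlinarith, fun hle => ⟨le_antisymm ?_ h1, trivial⟩⟩
    nlinarith
  · have := (reduced_form_right x y hc hca hab hy).1
    exact ⟨by linarith, fun hle => by linarith⟩

end ReducedForm

/-- The coefficient of `q^(‖l‖² + ‖m‖²)` contributed by the pair `(l, m)`. -/
def pairCoeff (l m : Fin 2 → ℝ) : ℝ := ip l m * det2 l m * (nsq m - nsq l)

theorem pairCoeff_swap (l m : Fin 2 → ℝ) : pairCoeff m l = pairCoeff l m := by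
  simp [pairCoeff, ip, det2, nsq]; ring

theorem pairCoeff_smul (v w : Fin 2 → ℝ) {s t : ℝ} (hs : s ^ 2 = 1) (ht : t ^ 2 = 1) :
    pairCoeff (s • v) (t • w) = pairCoeff v w := by
  have h1 : nsq (s • v) = s ^ 2 * nsq v := by simp [nsq]; ring
  have h2 : nsq (t • w) = t ^ 2 * nsq w := by simp [nsq]; ring
  have h3 : ip (s • v) (t • w) * det2 (s • v) (t • w) =
      s ^ 2 * t ^ 2 * (ip v w * det2 v w) := by simp [ip, det2]; ring
  rw [pairCoeff, h3, h1, h2, hs, ht, pairCoeff]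
  ring

/-- For a strictly reduced basis `(v, w)`, only the pairs `(±v, ±w)` and `(±w, ±v)` contribute
at the lowest exponent. -/
theorem pairCoeff_minimal {v w : Fin 2 → ℝ} (hc : 0 < 2 * ip v w) (hca : 2 * ip v w < nsq v)
    (hab : nsq v < nsq w) {l m : Fin 2 → ℝ} (hl : l ∈ intSpan v w) (hm : m ∈ intSpan v w)
    (h0 : pairCoeff l m ≠ 0) :
    nsq v + nsq w ≤ nsq l + nsq m ∧
      (nsq l + nsq m = nsq v + nsq w → pairCoeff l m = pairCoeff v w) := by
  obtain ⟨x, y, rfl⟩ := hl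
  obtain ⟨x', y', rfl⟩ := hm
  have hdet : (x : ℝ) * y' - y * x' ≠ 0 := by
    rintro h
    apply h0
    rw [pairCoeff, det2_comb, h]
    ring
  have hxy : x ≠ 0 ∨ y ≠ 0 := by
    by_contra! h; simp [h.1, h.2] at hdet
  have hxy' : x' ≠ 0 ∨ y' ≠ 0 := by
    by_contra! h; simp [h.1, h.2] at hdet
  by_cases hy : y = 0
  · have hy' : y' ≠ 0 := by rintro rfl; simp [hy] at hdet
    have h1 := reduced_form_left x y hc hca hab hxy
    have h2 := reduced_form_right x' y' hc hca hab hy'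
    rw [← nsq_comb] at h1 h2
    refine ⟨by linarith [h1.1, h2.1], fun h => ?_⟩
    obtain ⟨hx1, rfl⟩ := h1.2 (by linarith [h2.1])
    obtain ⟨rfl, hy1⟩ := h2.2 (by linarith [h1.1])
    simpa using pairCoeff_smul v w hx1 hy1
  · have h1 := reduced_form_right x y hc hca hab hy
    have h2 := reduced_form_left x' y' hc hca hab hxy'
    rw [← nsq_comb] at h1 h2
    refine ⟨by linarith [h1.1, h2.1], fun h => ?_⟩
    obtain ⟨rfl, hy1⟩ := h1.2 (by linarith [h2.1])
    obtain ⟨hx1, rfl⟩ := h2.2 (by linarith [h1.1])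
    rw [pairCoeff_swap]
    simpa using pairCoeff_smul v w hx1 hy1

theorem summable_exp_neg_mul_int_sq {δ : ℝ} (hδ : 0 < δ) :
    Summable fun n : ℤ => Real.exp (-(δ * (n : ℝ) ^ 2)) := by
  have hτ : 0 < (((δ / Real.pi : ℝ) : ℂ) * Complex.I).im := by
    simp; positivity
  have hs := ((summable_jacobiTheta₂_term_iff 0 _).2 hτ).norm
  refine hs.congr fun n => ?_
  rw [jacobiTheta₂_term, Complex.norm_exp, mul_zero, zero_add]
  congr 1
  have : (Real.pi : ℂ) * Complex.I * (n : ℂ) ^ 2 * (((δ / Real.pi : ℝ) : ℂ) * Complex.I) =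
      ((-(δ * (n : ℝ) ^ 2) : ℝ) : ℂ) := by
    have hpi : (Real.pi : ℂ) ≠ 0 := by exact_mod_cast Real.pi_ne_zero
    push_cast
    field_simp
    rw [Complex.I_sq]
    ring
  rw [this, Complex.ofReal_re]

theorem summable_exp_neg_nsq {b : Fin 2 → Fin 2 → ℝ} (hb : LinearIndependent ℝ b) :
    Summable fun c : Fin 2 → ℤ => Real.exp (-nsq (LV b c)) := by
  obtain ⟨δ, hδ, h⟩ := exists_pos_mul_le_nsq hb
  have h1 := summable_exp_neg_mul_int_sq hδ
  have h2 := h1.mul_of_nonneg h1 (fun _ => (Real.exp_pos _).le) (fun _ => (Real.exp_pos _).le)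
  have h3 := (finTwoArrowEquiv ℤ).summable_iff.2 h2
  refine h3.of_nonneg_of_le (fun _ => (Real.exp_pos _).le) fun c => ?_
  change _ ≤ Real.exp (-(δ * (c 0 : ℝ) ^ 2)) * Real.exp (-(δ * (c 1 : ℝ) ^ 2))
  rw [← Real.exp_add, Real.exp_le_exp]
  linarith [h c]

theorem abs_pairCoeff_le (l m : Fin 2 → ℝ) : |pairCoeff l m| ≤ (nsq l + nsq m) ^ 3 := by
  have hl := nsq_nonneg l
  have hm := nsq_nonneg m
  have h1 : |ip l m| ≤ nsq l + nsq m := by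
    simp only [ip, nsq, Fin.sum_univ_two]
    rw [abs_le]
    constructor <;> nlinarith [sq_nonneg (l 0 + m 0), sq_nonneg (l 1 + m 1),
      sq_nonneg (l 0 - m 0), sq_nonneg (l 1 - m 1), sq_nonneg (l 0), sq_nonneg (l 1),
      sq_nonneg (m 0), sq_nonneg (m 1)]
  have h2 : |det2 l m| ≤ nsq l + nsq m := by
    simp only [det2, nsq, Fin.sum_univ_two]
    rw [abs_le]
    constructor <;> nlinarith [sq_nonneg (l 0 + m 1), sq_nonneg (l 1 + m 0),
      sq_nonneg (l 0 - m 1), sq_nonneg (l 1 - m 0), sq_nonneg (l 0), sq_nonneg (l 1),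
      sq_nonneg (m 0), sq_nonneg (m 1)]
  have h3 : |nsq m - nsq l| ≤ nsq l + nsq m := by
    rw [abs_le]; constructor <;> linarith
  rw [pairCoeff, abs_mul, abs_mul, pow_succ, sq]
  gcongr

theorem summable_pairCoeff_mul_exp {b : Fin 2 → Fin 2 → ℝ} (hb : LinearIndependent ℝ b) :
    Summable fun p : (Fin 2 → ℤ) × (Fin 2 → ℤ) =>
      |pairCoeff (LV b p.1) (LV b p.2)| *
        Real.exp (-(2 * Real.pi * (nsq (LV b p.1) + nsq (LV b p.2)))) := by
  have h1 := summable_exp_neg_nsq hb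
  have h2 := h1.mul_of_nonneg h1 (fun _ => (Real.exp_pos _).le) (fun _ => (Real.exp_pos _).le)
  refine (h2.mul_left 6).of_nonneg_of_le (fun _ => by positivity) fun p => ?_
  set E := nsq (LV b p.1) + nsq (LV b p.2) with hE
  have hE0 : 0 ≤ E := add_nonneg (nsq_nonneg _) (nsq_nonneg _)
  have h3 : E ^ 3 ≤ 6 * Real.exp E := by
    have := Real.pow_div_factorial_le_exp E hE0 3
    norm_num [Nat.factorial] at this
    linarith
  calc _ ≤ (6 * Real.exp E) * Real.exp (-(2 * E)) := by
        gcongr ?_ * Real.exp (-?_)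
        · exact (abs_pairCoeff_le _ _).trans h3
        · gcongr
          linarith [Real.pi_gt_three]
    _ = 6 * (Real.exp (-nsq (LV b p.1)) * Real.exp (-nsq (LV b p.2))) := by
        rw [← Real.exp_add, mul_assoc, ← Real.exp_add]
        congr 2
        rw [hE]; ring

theorem eq2_mul_I (t y : ℝ) :
    eq2 t (y * Complex.I) = (Real.exp (-(2 * Real.pi * t * y)) : ℂ) := by
  rw [eq2, Complex.ofReal_exp]
  congr 1
  push_cast
  linear_combination (2 * Real.pi * t * y : ℂ) * Complex.I_sq

open Filter Topology in
/-- If the coefficients at exponents below `m` vanish and those at exponent `m` are nonnegative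
and not all zero, then the exponential series does not vanish identically. -/
theorem exists_tsum_mul_exp_ne_zero {ι : Type*} {f E : ι → ℝ} {m K : ℝ} (hK : K ≠ 0)
    (hf : Summable fun i => |f i| * Real.exp (-(2 * Real.pi * E i)))
    (hmin : ∀ i, f i ≠ 0 → m ≤ E i) (heq : ∀ i, f i ≠ 0 → E i = m → f i = K)
    (hex : ∃ i, E i = m ∧ f i = K) :
    ∃ y : ℝ, 0 < y ∧ ∑' i, f i * Real.exp (-(2 * Real.pi * E i * y)) ≠ 0 := by
  classical
  by_contra! hzero
  let g : ι → ℝ := fun i => if E i = m then f i else 0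
  let F : ℝ → ι → ℝ := fun y i => f i * Real.exp (-(2 * Real.pi * (E i - m) * y))
  have hbound : Summable fun i => |f i| * Real.exp (-(2 * Real.pi * (E i - m))) := by
    refine (hf.mul_right (Real.exp (2 * Real.pi * m))).congr fun i => ?_
    rw [mul_assoc, ← Real.exp_add]
    congr 2
    ring
  have hlim : Tendsto (fun y => ∑' i, F y i) atTop (𝓝 (∑' i, g i)) := by
    refine tendsto_tsum_of_dominated_convergence hbound (fun i => ?_) ?_
    · by_cases h0 : f i = 0
      · simp [F, g, h0]
      rcases (hmin i h0).eq_or_lt with h | h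
      · simp [F, g, ← h]
      · have hpos : 0 < 2 * Real.pi * (E i - m) := by
          have := sub_pos.2 h
          positivity
        simp only [F, g, if_neg h.ne']
        rw [show (0 : ℝ) = f i * 0 by simp]
        refine Tendsto.const_mul _ (Real.tendsto_exp_neg_atTop_nhds_zero.comp ?_)
        exact tendsto_id.const_mul_atTop hpos
    · filter_upwards [eventually_ge_atTop 1] with y hy i
      by_cases h0 : f i = 0
      · simp [F, h0]
      have hnn : 0 ≤ 2 * Real.pi * (E i - m) := by
        have := sub_nonneg.2 (hmin i h0)
        positivity
      simp only [F, norm_mul, Real.norm_eq_abs, Real.abs_exp]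
      gcongr |f i| * Real.exp (-?_)
      exact le_mul_of_one_le_right hnn hy
  have hF0 : ∀ᶠ y in atTop, ∑' i, F y i = 0 := by
    filter_upwards [eventually_gt_atTop 0] with y hy
    have : ∀ i, F y i = f i * Real.exp (-(2 * Real.pi * E i * y)) *
        Real.exp (2 * Real.pi * m * y) := by
      intro i
      rw [mul_assoc (f i), ← Real.exp_add]
      change f i * Real.exp _ = _
      congr 2
      ring
    simp_rw [this]
    rw [tsum_mul_right, hzero y hy, zero_mul]
  have hg0 : ∑' i, g i = 0 :=
    tendsto_nhds_unique hlim ((tendsto_congr' hF0).2 tendsto_const_nhds)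
  have hg : Summable g := by
    refine Summable.of_norm_bounded hbound fun i => ?_
    by_cases h : E i = m
    · simp [g, h]
    · simp only [g, if_neg h, norm_zero]; positivity
  obtain ⟨i₀, hi₀, hf₀⟩ := hex
  have hKg : 0 < ∑' i, K * g i := by
    refine (hg.mul_left K).tsum_pos (fun i => ?_) i₀ ?_
    · by_cases h : E i = m
      · by_cases h0 : f i = 0
        · simp [g, h0]
        · simp only [g, if_pos h, heq i h0 h]
          exact mul_self_nonneg K
      · simp [g, h]
    · simp only [g, if_pos hi₀, hf₀]
      exact mul_self_pos.2 hK
  rw [tsum_mul_left, hg0, mul_zero] at hKg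
  exact hKg.false

/-- Let `Λ ⊂ ℝ²` be a lattice such that no ℤ-basis `(λ₁, λ₂)` of `Λ` satisfies
`⟨λ₁,λ₂⟩ = 0`, or `2⟨λ₁,λ₂⟩ = ‖λ₁‖²`, or `‖λ₁‖ = ‖λ₂‖`.  Then `det DΘ_Λ` is not
identically zero on the upper half plane. -/
theorem detDTheta_ne_zero_of_no_special_basis
    (b : Fin 2 → Fin 2 → ℝ) (hb : LinearIndependent ℝ b)
    (Λ : Set (Fin 2 → ℝ)) (hΛ : Λ = {x | ∃ c : Fin 2 → ℤ, x = LV b c})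
    (hnospecial : ∀ v w : Fin 2 → ℝ,
      {x | ∃ a a' : ℤ, x = (a : ℝ) • v + (a' : ℝ) • w} = Λ →
      ¬(ip v w = 0 ∨ 2 * ip v w = nsq v ∨ nsq v = nsq w)) :
    ∃ τ : ℂ, 0 < τ.im ∧ detDTheta b τ ≠ 0 := by
  rw [range_LV] at hΛ
  subst hΛ
  obtain ⟨v, w, hvw, hc, hca, hab⟩ := exists_reduced_basis hb hnospecial
  have hmem : ∀ c : Fin 2 → ℤ, LV b c ∈ intSpan v w := fun c => by
    rw [hvw, ← range_LV]; exact ⟨c, rfl⟩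
  have hdet : det2 v w ≠ 0 := by
    intro h0
    obtain ⟨x, y, h1⟩ : b 0 ∈ intSpan v w := hvw ▸ left_mem_intSpan _ _
    obtain ⟨x', y', h2⟩ : b 1 ∈ intSpan v w := hvw ▸ right_mem_intSpan _ _
    apply det2_ne_zero hb
    rw [h1, h2, det2_comb, h0, mul_zero]
  have hK : pairCoeff v w ≠ 0 :=
    mul_ne_zero (mul_ne_zero (by linarith) hdet) (sub_pos.2 hab).ne'
  obtain ⟨c, rfl⟩ : v ∈ {x | ∃ c : Fin 2 → ℤ, x = LV b c} := by
    rw [range_LV, ← hvw]; exact left_mem_intSpan _ _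
  obtain ⟨d, rfl⟩ : w ∈ {x | ∃ c : Fin 2 → ℤ, x = LV b c} := by
    rw [range_LV, ← hvw]; exact right_mem_intSpan _ _
  obtain ⟨y, hy, hne⟩ := exists_tsum_mul_exp_ne_zero hK (summable_pairCoeff_mul_exp hb)
    (fun p hp => (pairCoeff_minimal hc hca hab (hmem p.1) (hmem p.2) hp).1)
    (fun p hp => (pairCoeff_minimal hc hca hab (hmem p.1) (hmem p.2) hp).2)
    ⟨(c, d), rfl, rfl⟩
  refine ⟨y * Complex.I, by simpa using hy, mul_ne_zero (by norm_num) ?_⟩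
  simp_rw [eq2_mul_I, ← Complex.ofReal_mul]
  rw [← Complex.ofReal_tsum]
  exact Complex.ofReal_ne_zero.2 hne
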